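/- Let μ ∈ ℤⁿ and let y ∈ Gr_μ satisfy Φ_{α,k}(y) ≠ 0. Then ξ_α(y)^{−1}·y ∈ N(K)^α₁ · t^{μ+α} · T₁[[t⁻¹]] · N₋(K). In particular, there exist n ∈ N^α[t] and n₋ ∈ N₋[t] such that n·ξ_α(y)^{−1}·y·n₋ ∈ Gr_{μ+α}; hence π(ξ_α(y)^{−1}·y) ∈ Gr_{μ+α} is defined and equals n·ξ_α(y)^{−1}·y·n₋. -/

import Mathlib

open Matrix

noncomputable section

/-- `K = ℂ((t⁻¹))`, the field of formal Laurent series in `t⁻¹`.  We realize it as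
`LaurentSeries ℂ`, where the Laurent-series variable `X` plays the role of `t⁻¹`;
thus for `f : K`, `f.coeff j` is the coefficient of `t^{-j}`. -/
abbrev K : Type := LaurentSeries ℂ

/-- The element `t` (the inverse of the Laurent series variable). -/
def tK : K := (HahnSeries.single (-1 : ℤ) (1 : ℂ))

/-- The constant embedding `ℂ → K`. -/
def Cc (z : ℂ) : K := HahnSeries.C z

/-- `f ∈ 𝒪 = ℂ[[t⁻¹]]` : no positive powers of `t`. -/
def memO (f : K) : Prop := ∀ j : ℤ, j < 0 → f.coeff j = 0

/-- `f ∈ 𝒪₁ = t⁻¹ℂ[[t⁻¹]]`. -/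
def memO1 (f : K) : Prop := ∀ j : ℤ, j ≤ 0 → f.coeff j = 0

/-- `f ∈ ℂ[t]`. -/
def memPoly (f : K) : Prop := ∀ j : ℤ, 0 < j → f.coeff j = 0

/-- Upper unitriangular matrix. -/
def IsUpperUni {R : Type*} [Zero R] [One R] {m : ℕ} (M : Matrix (Fin m) (Fin m) R) : Prop :=
  (∀ i, M i i = 1) ∧ ∀ i j : Fin m, j < i → M i j = 0

/-- Lower unitriangular matrix. -/
def IsLowerUni {R : Type*} [Zero R] [One R] {m : ℕ} (M : Matrix (Fin m) (Fin m) R) : Prop :=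
  (∀ i, M i i = 1) ∧ ∀ i j : Fin m, i < j → M i j = 0

/-- `M ∈ N₁[[t⁻¹]]` : upper unitriangular with off-diagonal entries in `𝒪₁`. -/
def MemN1 {m : ℕ} (M : Matrix (Fin m) (Fin m) K) : Prop :=
  IsUpperUni M ∧ ∀ i j : Fin m, i ≠ j → memO1 (M i j)

/-- `M ∈ N₋,₁[[t⁻¹]]`. -/
def MemN1neg {m : ℕ} (M : Matrix (Fin m) (Fin m) K) : Prop :=
  IsLowerUni M ∧ ∀ i j : Fin m, i ≠ j → memO1 (M i j)

/-- `M ∈ T₁[[t⁻¹]]` : diagonal with entries in `1 + 𝒪₁`. -/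
def MemT1 {m : ℕ} (M : Matrix (Fin m) (Fin m) K) : Prop :=
  (∀ i j : Fin m, i ≠ j → M i j = 0) ∧ ∀ i, memO1 (M i i - 1)

/-- `M ∈ N[t]` : upper unitriangular with entries in `ℂ[t]`. -/
def MemNpoly {m : ℕ} (M : Matrix (Fin m) (Fin m) K) : Prop :=
  IsUpperUni M ∧ ∀ i j : Fin m, memPoly (M i j)

/-- `M ∈ N₋[t]` : lower unitriangular with entries in `ℂ[t]`. -/
def MemNnegPoly {m : ℕ} (M : Matrix (Fin m) (Fin m) K) : Prop :=
  IsLowerUni M ∧ ∀ i j : Fin m, memPoly (M i j)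

/-- `t^ν = diag(t^{ν₁},…,t^{ν_m})`. -/
def tPow {m : ℕ} (ν : Fin m → ℤ) : Matrix (Fin m) (Fin m) K :=
  Matrix.diagonal fun i => tK ^ ν i

/-- `y = u · h · t^ν · l` is a Gauss factorization exhibiting membership in `Gr_ν`. -/
def IsGauss {m : ℕ} (ν : Fin m → ℤ) (y u h l : Matrix (Fin m) (Fin m) K) : Prop :=
  MemN1 u ∧ MemT1 h ∧ MemN1neg l ∧ y = u * h * tPow ν * l

/-- The matrix slice `Gr_ν = N₁[[t⁻¹]]·T₁[[t⁻¹]]·t^ν·N₋,₁[[t⁻¹]]`. -/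
def GrSlice {m : ℕ} (ν : Fin m → ℤ) : Set (Matrix (Fin m) (Fin m) K) :=
  { y | ∃ u h l, IsGauss ν y u h l }

/-- Block embedding `τ_α : Mat_{k+1} → Mat_n` into (1-indexed) rows and columns `r₁,…,r₁+k`,
identity outside this block. -/
def blockEmbed {R : Type*} [Zero R] [One R] (n r₁ k : ℕ)
    (g : Matrix (Fin (k+1)) (Fin (k+1)) R) : Matrix (Fin n) (Fin n) R :=
  fun i j =>
    if h : r₁ - 1 ≤ (i : ℕ) ∧ (i : ℕ) ≤ r₁ - 1 + k ∧ r₁ - 1 ≤ (j : ℕ) ∧ (j : ℕ) ≤ r₁ - 1 + k then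
      g ⟨(i : ℕ) - (r₁ - 1), by omega⟩ ⟨(j : ℕ) - (r₁ - 1), by omega⟩
    else if i = j then 1 else 0

/-- The coweight `α` of `PGL_n` : `α_{r₁} = 1`, `α_{r₂+1} = -1` (1-indexed), all other
entries `0`. -/
def alphaCo (n r₁ r₂ : ℕ) : Fin n → ℤ :=
  fun i => if (i : ℕ) = r₁ - 1 then 1 else if (i : ℕ) = r₂ then -1 else 0

/-- The matrix `y(p,e,b,g)` (matrix representative of a point of the open Zastava
`Gr⁰_{-α}`), a `(k+1)×(k+1)` matrix over `ℂ[t] ⊆ K`. -/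
def ymat (k : ℕ) (p e : ℂ) (b g : Fin (k-1) → ℂ) :
    Matrix (Fin (k+1)) (Fin (k+1)) K :=
  fun i j =>
    if _hi0 : (i : ℕ) = 0 then
      (if _hjk : (j : ℕ) = k then Cc e else 0)
    else if _hik : (i : ℕ) = k then
      (if _hj0 : (j : ℕ) = 0 then Cc (-e⁻¹)
       else if _hjk : (j : ℕ) = k then tK - Cc (p + ∑ l : Fin (k-1), b l * g l)
       else Cc (-(g ⟨k - (j : ℕ) - 1, by have := j.isLt; omega⟩)))
    else
      (if _hji : (j : ℕ) = (i : ℕ) then 1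
       else if _hjk : (j : ℕ) = k then Cc (b ⟨k - (i : ℕ) - 1, by have := i.isLt; omega⟩)
       else 0)

/-- The matrix `x₋(v)` over `K` : identity except for the bottom row `(v_k,…,v₁,1)`. -/
def xminusK (k : ℕ) (v : Fin k → ℂ) : Matrix (Fin (k+1)) (Fin (k+1)) K :=
  fun i j =>
    if _hik : (i : ℕ) = k then
      (if _hjk : (j : ℕ) = k then 1 else Cc (v ⟨k - (j : ℕ) - 1, by have := j.isLt; omega⟩))
    else if i = j then 1 else 0

/-- `Φ_α(y)` read off from the `N₁[[t⁻¹]]`-factor `u` of a Gauss factorization of `y`. -/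
def PhiOf (n r₂ k : ℕ) (hrn : r₂ < n) (u : Matrix (Fin n) (Fin n) K) : Fin k → ℂ :=
  fun a => (u ⟨r₂ - 1 - (a : ℕ), by omega⟩ ⟨r₂, hrn⟩).coeff 1

/-- `ζ_α(y)` read off from the `N₁[[t⁻¹]]`-factor `u` of a Gauss factorization of `y`. -/
def ZetaOf (n r₁ r₂ k : ℕ) (hr1 : 1 ≤ r₁) (hrr : r₁ ≤ r₂) (hrn : r₂ < n)
    (hk : k = r₂ - r₁ + 1) (u : Matrix (Fin n) (Fin n) K) : Fin k → ℂ :=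
  fun a =>
    if _ha : (a : ℕ) = k - 1 then (u ⟨r₁ - 1, by omega⟩ ⟨r₂, hrn⟩).coeff 2
    else (u ⟨r₁ - 1, by omega⟩ ⟨r₁ + (a : ℕ), by have := a.isLt; omega⟩).coeff 1

/-- `ξ_α(y)`, computed from the `N₁[[t⁻¹]]`-factor `u` of a Gauss factorization of `y`. -/
def xiOf (n r₁ r₂ k : ℕ) (hr1 : 1 ≤ r₁) (hrr : r₁ ≤ r₂) (hrn : r₂ < n)
    (hk : k = r₂ - r₁ + 1) (u : Matrix (Fin n) (Fin n) K) : Matrix (Fin n) (Fin n) K :=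
  let c := PhiOf n r₂ k hrn u
  let z := ZetaOf n r₁ r₂ k hr1 hrr hrn hk u
  let e : ℂ := c ⟨k - 1, by omega⟩
  let b : Fin (k-1) → ℂ := fun i => c ⟨(i : ℕ), by have := i.isLt; omega⟩
  let g : Fin (k-1) → ℂ := fun i => z ⟨k - (i : ℕ) - 2, by omega⟩ / e
  let p : ℂ := z ⟨k - 1, by omega⟩ / e - ∑ i : Fin (k-1), b i * g i
  blockEmbed n r₁ k (ymat k p e b g)

/-- `M` has identity submatrix in (1-indexed) rows and columns `r₁,…,r₁+k`. -/
def HasIdBlock {R : Type*} [Zero R] [One R] {n : ℕ} (r₁ k : ℕ)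
    (M : Matrix (Fin n) (Fin n) R) : Prop :=
  ∀ i j : Fin n, r₁ - 1 ≤ (i : ℕ) → (i : ℕ) ≤ r₁ - 1 + k →
    r₁ - 1 ≤ (j : ℕ) → (j : ℕ) ≤ r₁ - 1 + k →
    M i j = if i = j then 1 else 0

/-- `M ∈ N^α(K)` : upper unitriangular over `K` with identity `(k+1)×(k+1)`-block. -/
def MemNalphaK (n r₁ k : ℕ) (M : Matrix (Fin n) (Fin n) K) : Prop :=
  IsUpperUni M ∧ HasIdBlock r₁ k M

/-- `M ∈ N^α[t]`. -/
def MemNalphaPoly (n r₁ k : ℕ) (M : Matrix (Fin n) (Fin n) K) : Prop :=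
  MemNalphaK n r₁ k M ∧ ∀ i j : Fin n, memPoly (M i j)

/-- `M ∈ N(K)^α₁ = x_α(N_{1,k+1}[[t⁻¹]])·N^α(K)`. -/
def MemNKalpha1 (n r₁ k : ℕ) (M : Matrix (Fin n) (Fin n) K) : Prop :=
  ∃ (a : Matrix (Fin (k+1)) (Fin (k+1)) K) (u : Matrix (Fin n) (Fin n) K),
    MemN1 a ∧ MemNalphaK n r₁ k u ∧ M = blockEmbed n r₁ k a * u

/-- `z = π(x)` for the slice `Gr_ν` : `z ∈ Gr_ν` and `z = a·x·b` with `a ∈ N[t]`,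
`b ∈ N₋[t]`. -/
def IsPiOf {n : ℕ} (ν : Fin n → ℤ) (x z : Matrix (Fin n) (Fin n) K) : Prop :=
  z ∈ GrSlice ν ∧ ∃ a b, MemNpoly a ∧ MemNnegPoly b ∧ z = a * x * b

/-- The open Zastava slice `Gr⁰_{-α} ⊆ GL_n(K)` : matrices `τ_α(y(p,e,b,g))`. -/
def GrZeroNegAlpha (n r₁ k : ℕ) : Set (Matrix (Fin n) (Fin n) K) :=
  { M | ∃ (p e : ℂ) (b g : Fin (k-1) → ℂ), e ≠ 0 ∧ M = blockEmbed n r₁ k (ymat k p e b g) }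

/-- `μ + α`. -/
def addAlpha (n r₁ r₂ : ℕ) (μ : Fin n → ℤ) : Fin n → ℤ :=
  fun i => μ i + alphaCo n r₁ r₂ i


/-! ### The filtration of `K` by powers of `t⁻¹` -/

/-- The additive subgroup `t^{-d} ℂ[[t⁻¹]]` of `K`. -/
def filt (d : ℤ) : AddSubgroup K where
  carrier := { f | ∀ j : ℤ, j < d → f.coeff j = 0 }
  zero_mem' := by intro j _; simp
  add_mem' := by
    intro f g hf hg j hj
    simp [hf j hj, hg j hj]
  neg_mem' := by
    intro f hf j hj
    simp [hf j hj]

theorem memO1_iff_mem_filt {f : K} : memO1 f ↔ f ∈ filt 1 :=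
  forall_congr' fun j => by rw [show j ≤ 0 ↔ j < 1 by omega]

theorem filt_anti {c d : ℤ} (h : c ≤ d) {f : K} (hf : f ∈ filt d) : f ∈ filt c :=
  fun j hj => hf j (hj.trans_le h)

theorem mul_mem_filt {c d : ℤ} {f g : K} (hf : f ∈ filt c) (hg : g ∈ filt d) :
    f * g ∈ filt (c + d) := by
  intro j hj
  rw [HahnSeries.coeff_mul]
  refine Finset.sum_eq_zero fun x hx => ?_
  rw [Finset.mem_antidiagonal] at hx
  obtain ⟨-, -, hx⟩ := hx
  by_cases h : x.1 < c
  · rw [hf _ h, zero_mul]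
  · rw [hg x.2 (by omega), mul_zero]

theorem mul_mem_filt_one_left {f g : K} (hf : f ∈ filt 1) (hg : g ∈ filt 0) :
    f * g ∈ filt 1 := by
  simpa using mul_mem_filt hf hg

theorem mul_mem_filt_one_right {f g : K} (hf : f ∈ filt 0) (hg : g ∈ filt 1) :
    f * g ∈ filt 1 := by
  simpa using mul_mem_filt hf hg

theorem coeff_Cc_mul (z : ℂ) (f : K) (j : ℤ) : (Cc z * f).coeff j = z * f.coeff j := by
  simp [Cc]

theorem coeff_tK_mul (f : K) (j : ℤ) : (tK * f).coeff j = f.coeff (j + 1) := by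
  simp [tK, HahnSeries.coeff_single_mul]

theorem tK_ne_zero : tK ≠ 0 := by
  simp [tK]

theorem Cc_mem_filt (z : ℂ) : Cc z ∈ filt 0 := by
  intro j hj
  exact HahnSeries.coeff_single_of_ne hj.ne

theorem one_mem_filt : (1 : K) ∈ filt 0 := by
  simpa [Cc] using Cc_mem_filt 1

theorem tK_inv_mem_filt : tK⁻¹ ∈ filt 1 := by
  intro j hj
  have h : tK⁻¹ = HahnSeries.single (1 : ℤ) (1 : ℂ) := by
    rw [inv_eq_iff_eq_inv, eq_comm]
    simp [tK]
  rw [h, HahnSeries.coeff_single_of_ne hj.ne]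

theorem mem_filt_zero_of_sub_one_mem {f : K} (hf : f - 1 ∈ filt 1) : f ∈ filt 0 := by
  simpa using add_mem (filt_anti zero_le_one hf) one_mem_filt

theorem ne_zero_of_sub_one_mem {f : K} (hf : f - 1 ∈ filt 1) : f ≠ 0 := by
  rintro rfl
  simpa using hf 0 zero_lt_one

theorem inv_mem_filt_zero {f : K} (hf : f - 1 ∈ filt 1) : f⁻¹ ∈ filt 0 := by
  have hf0 := ne_zero_of_sub_one_mem hf
  have h0 : f.coeff 0 ≠ 0 := by
    have := hf 0 zero_lt_one
    intro h
    simp [h] at this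
  have hord : 0 ≤ f⁻¹.order := by
    have h1 := HahnSeries.order_mul hf0 (inv_ne_zero hf0)
    rw [mul_inv_cancel₀ hf0, HahnSeries.order_one] at h1
    have h2 := HahnSeries.order_le_of_coeff_ne_zero h0
    omega
  exact fun j hj => HahnSeries.coeff_eq_zero_of_lt_order (hj.trans_le hord)

theorem mul_sub_one_mem {f g : K} (hf : f - 1 ∈ filt 1) (hg : g - 1 ∈ filt 1) :
    f * g - 1 ∈ filt 1 := by
  have h := add_mem (mul_mem_filt_one_left hf (mem_filt_zero_of_sub_one_mem hg)) hg
  convert h using 1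
  ring

/-- The polynomial part in `t` of a Laurent series in `t⁻¹`. -/
def polyPart (f : K) : K := HahnSeries.truncLT (1 : ℤ) f

theorem memPoly_polyPart (f : K) : memPoly (polyPart f) :=
  fun _ hj => HahnSeries.coeff_truncLT_of_le (by omega) _

theorem sub_polyPart_mem (f : K) : f - polyPart f ∈ filt 1 := by
  intro j hj
  rw [HahnSeries.coeff_sub, polyPart, HahnSeries.coeff_truncLT_of_lt hj, sub_self]

theorem polyPart_zero : polyPart 0 = 0 := by
  rw [polyPart, map_zero]

/-! ### Matrices supported above the diagonal for a grading of the indices -/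

/-- `X i j` vanishes unless `c i < c j`. -/
def StrictUpper {m : ℕ} (c : Fin m → ℕ) (X : Matrix (Fin m) (Fin m) K) : Prop :=
  ∀ i j, c j ≤ c i → X i j = 0

/-- `X i j` vanishes unless `c i = c j`. -/
def Graded {m : ℕ} (c : Fin m → ℕ) (X : Matrix (Fin m) (Fin m) K) : Prop :=
  ∀ i j, c i ≠ c j → X i j = 0

section Triangular

variable {m : ℕ} {c : Fin m → ℕ} {X Y : Matrix (Fin m) (Fin m) K}

theorem StrictUpper.add (hX : StrictUpper c X) (hY : StrictUpper c Y) : StrictUpper c (X + Y) :=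
  fun i j h => by rw [Matrix.add_apply, hX i j h, hY i j h, add_zero]

theorem StrictUpper.mul (hX : StrictUpper c X) (hY : StrictUpper c Y) :
    StrictUpper c (X * Y) := by
  intro i j h
  rw [Matrix.mul_apply]
  refine Finset.sum_eq_zero fun l _ => ?_
  rcases le_or_gt (c l) (c i) with h1 | h1
  · rw [hX i l h1, zero_mul]
  · rw [hY l j (h.trans h1.le), mul_zero]

theorem StrictUpper.graded_mul (hX : Graded c X) (hY : StrictUpper c Y) :
    StrictUpper c (X * Y) := by
  intro i j h
  rw [Matrix.mul_apply]
  refine Finset.sum_eq_zero fun l _ => ?_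
  by_cases h1 : c i = c l
  · rw [hY l j (h1 ▸ h), mul_zero]
  · rw [hX i l h1, zero_mul]

theorem StrictUpper.mul_graded (hX : StrictUpper c X) (hY : Graded c Y) :
    StrictUpper c (X * Y) := by
  intro i j h
  rw [Matrix.mul_apply]
  refine Finset.sum_eq_zero fun l _ => ?_
  by_cases h1 : c l = c j
  · rw [hX i l (h1 ▸ h), zero_mul]
  · rw [hY l j h1, mul_zero]

theorem Graded.mul (hX : Graded c X) (hY : Graded c Y) : Graded c (X * Y) := by
  intro i j h
  rw [Matrix.mul_apply]
  refine Finset.sum_eq_zero fun l _ => ?_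
  by_cases h1 : c i = c l
  · rw [hY l j (h1 ▸ h), mul_zero]
  · rw [hX i l h1, zero_mul]

/-- Graded invertible matrices normalize the group `1 + StrictUpper c`. -/
theorem StrictUpper.conj_sub_one {V Q Q' : Matrix (Fin m) (Fin m) K}
    (hV : StrictUpper c (V - 1)) (hQ : Graded c Q) (hQ' : Graded c Q') (h : Q * Q' = 1) :
    StrictUpper c (Q * V * Q' - 1) := by
  have h1 : Q * V * Q' - 1 = Q * (V - 1) * Q' := by
    rw [mul_sub, sub_mul, mul_one, h]
  rw [h1]
  exact (hV.graded_mul hQ).mul_graded hQ'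

theorem StrictUpper.mul_sub_one (hX : StrictUpper c (X - 1)) (hY : StrictUpper c (Y - 1)) :
    StrictUpper c (X * Y - 1) := by
  have h1 : X * Y - 1 = (X - 1) + (Y - 1) + (X - 1) * (Y - 1) := by
    simp only [sub_mul, mul_sub, one_mul, mul_one]
    abel
  rw [h1]
  exact (hX.add hY).add (hX.mul hY)

theorem isUpperUni_iff_strictUpper : IsUpperUni X ↔ StrictUpper (fun i => (i : ℕ)) (X - 1) := by
  constructor
  · rintro ⟨h1, h2⟩ i j hij
    rw [Matrix.sub_apply]
    rcases eq_or_lt_of_le (show j ≤ i from hij) with rfl | h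
    · rw [h1, Matrix.one_apply_eq, sub_self]
    · rw [h2 i j h, Matrix.one_apply_ne h.ne', sub_self]
  · intro h
    refine ⟨fun i => ?_, fun i j hij => ?_⟩
    · simpa [sub_eq_zero] using h i i le_rfl
    · simpa [Matrix.one_apply_ne hij.ne'] using h i j hij.le

theorem isUpperUni_mul (hX : IsUpperUni X) (hY : IsUpperUni Y) : IsUpperUni (X * Y) := by
  rw [isUpperUni_iff_strictUpper] at *
  exact hX.mul_sub_one hY

theorem isUpperUni_transpose : IsUpperUni Xᵀ ↔ IsLowerUni X :=
  and_congr Iff.rfl ⟨fun h i j => h j i, fun h i j => h j i⟩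

theorem isLowerUni_transpose : IsLowerUni Xᵀ ↔ IsUpperUni X :=
  and_congr Iff.rfl ⟨fun h i j => h j i, fun h i j => h j i⟩

theorem isLowerUni_mul (hX : IsLowerUni X) (hY : IsLowerUni Y) : IsLowerUni (X * Y) := by
  rw [← isUpperUni_transpose] at *
  rw [Matrix.transpose_mul]
  exact isUpperUni_mul hY hX

theorem isLowerUni_diagonal_conj {d d' : Fin m → K} (hd : ∀ i, d i * d' i = 1)
    (hX : IsLowerUni X) : IsLowerUni (Matrix.diagonal d * X * Matrix.diagonal d') := by
  constructor
  · intro i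
    rw [Matrix.mul_diagonal, Matrix.diagonal_mul, hX.1, mul_one, hd]
  · intro i j hij
    rw [Matrix.mul_diagonal, Matrix.diagonal_mul, hX.2 i j hij, mul_zero, zero_mul]

theorem memN1_mul (hX : MemN1 X) (hY : MemN1 Y) : MemN1 (X * Y) := by
  refine ⟨isUpperUni_mul hX.1 hY.1, fun i j hij => ?_⟩
  have hO : ∀ {Z : Matrix (Fin m) (Fin m) K}, MemN1 Z → ∀ i j, Z i j ∈ filt 0 := by
    intro Z hZ i j
    by_cases h : i = j
    · rw [h, hZ.1.1]
      exact one_mem_filt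
    · exact filt_anti zero_le_one (memO1_iff_mem_filt.1 (hZ.2 i j h))
  rw [memO1_iff_mem_filt, Matrix.mul_apply]
  refine sum_mem fun l _ => ?_
  by_cases h : i = l
  · exact mul_mem_filt_one_right (hO hX i l) (memO1_iff_mem_filt.1 (hY.2 l j (h ▸ hij)))
  · exact mul_mem_filt_one_left (memO1_iff_mem_filt.1 (hX.2 i l h)) (hO hY l j)

theorem exists_mul_eq_one_of_isUpperUni (hX : IsUpperUni X) : ∃ Y, Y * X = 1 ∧ X * Y = 1 := by
  have hdet : X.det = 1 := by
    have ht : X.BlockTriangular id := fun i j hij => hX.2 i j hij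
    rw [Matrix.det_of_isUpperTriangular ht]
    exact Finset.prod_eq_one fun i _ => hX.1 i
  have hu : IsUnit X.det := by rw [hdet]; exact isUnit_one
  exact ⟨X⁻¹, Matrix.nonsing_inv_mul X hu, Matrix.mul_nonsing_inv X hu⟩

theorem exists_mul_eq_one_of_isLowerUni (hX : IsLowerUni X) : ∃ Y, Y * X = 1 ∧ X * Y = 1 := by
  obtain ⟨Y, h1, h2⟩ := exists_mul_eq_one_of_isUpperUni (isUpperUni_transpose.2 hX)
  refine ⟨Yᵀ, ?_, ?_⟩
  · rw [← Matrix.transpose_transpose X, ← Matrix.transpose_mul, h2, Matrix.transpose_one]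
  · rw [← Matrix.transpose_transpose X, ← Matrix.transpose_mul, h1, Matrix.transpose_one]

end Triangular

/-! ### Splitting off polynomial parts -/

/-- Row `i` of the polynomial unitriangular matrix `P` for which `P * M` has no polynomial
part above the diagonal. -/
def polyRow {m : ℕ} (M : Matrix (Fin m) (Fin m) K) (i : Fin m) (j : Fin m) : K :=
  if j < i then 0 else if i = j then 1 else
    -polyPart (M i j + ∑ l : Fin m, if _h : i < l ∧ l < j then polyRow M i l * M l j else 0)
termination_by (j : ℕ)
decreasing_by exact _h.2

theorem polyRow_of_lt {m : ℕ} (M : Matrix (Fin m) (Fin m) K) {i j : Fin m} (h : i < j) :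
    polyRow M i j = -polyPart (M i j +
      ∑ l : Fin m, if i < l ∧ l < j then polyRow M i l * M l j else 0) := by
  rw [polyRow, if_neg h.not_gt, if_neg h.ne]
  simp only [dite_eq_ite]

theorem isUpperUni_polyRow {m : ℕ} (M : Matrix (Fin m) (Fin m) K) :
    IsUpperUni (Matrix.of (polyRow M)) := by
  constructor
  · intro i
    rw [Matrix.of_apply, polyRow, if_neg (lt_irrefl i), if_pos rfl]
  · intro i j hij
    rw [Matrix.of_apply, polyRow, if_pos hij]

theorem memPoly_polyRow {m : ℕ} (M : Matrix (Fin m) (Fin m) K) (i j : Fin m) :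
    memPoly (polyRow M i j) := by
  intro d hd
  rw [polyRow]
  split_ifs
  · simp
  · rw [HahnSeries.coeff_one, if_neg hd.ne']
  · rw [HahnSeries.coeff_neg, memPoly_polyPart _ d hd, neg_zero]

theorem memN1_polyRow_mul {m : ℕ} {M : Matrix (Fin m) (Fin m) K} (hM : IsUpperUni M) :
    MemN1 (Matrix.of (polyRow M) * M) := by
  have hP := isUpperUni_polyRow M
  refine ⟨isUpperUni_mul hP hM, fun i j hij => ?_⟩
  rcases lt_or_gt_of_ne hij with h | h
  · rw [memO1_iff_mem_filt, Matrix.mul_apply]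
    have hsum : ∑ l, Matrix.of (polyRow M) i l * M l j =
        M i j + (∑ l : Fin m, if i < l ∧ l < j then polyRow M i l * M l j else 0) +
          polyRow M i j := by
      have hterm : ∀ l, Matrix.of (polyRow M) i l * M l j =
          (if l = i then M i j else 0) +
            (if i < l ∧ l < j then polyRow M i l * M l j else 0) +
            (if l = j then polyRow M i j else 0) := by
        intro l
        rcases lt_trichotomy l i with h1 | rfl | h1
        · rw [hP.2 i l h1, if_neg h1.ne, if_neg (by simp [h1.le]), if_neg (h1.trans h).ne]
          ring
        · rw [hP.1, if_pos rfl, if_neg (by simp), if_neg h.ne]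
          ring
        · rw [if_neg h1.ne']
          rcases lt_trichotomy l j with h2 | rfl | h2
          · rw [if_pos ⟨h1, h2⟩, if_neg h2.ne, Matrix.of_apply]
            ring
          · rw [hM.1, if_neg (by simp), if_pos rfl, Matrix.of_apply]
            ring
          · rw [hM.2 l j h2, if_neg (by simp [h2.le]), if_neg h2.ne']
            ring
      simp only [hterm, Finset.sum_add_distrib, Finset.sum_ite_eq', Finset.mem_univ, if_true]
    rw [hsum, polyRow_of_lt M h, ← sub_eq_add_neg]
    exact sub_polyPart_mem _
  · intro d _
    rw [(isUpperUni_mul hP hM).2 i j h]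
    simp

theorem strictUpper_polyRow {m : ℕ} {M : Matrix (Fin m) (Fin m) K} {c : Fin m → ℕ}
    (hc : Monotone c) (hM : StrictUpper c (M - 1)) :
    StrictUpper c (Matrix.of (polyRow M) - 1) := by
  intro i j hij
  have hP := isUpperUni_polyRow M
  rw [Matrix.sub_apply, sub_eq_zero]
  rcases lt_trichotomy i j with h | rfl | h
  · have hM0 : ∀ l, i ≤ l → l < j → M l j = 0 := by
      intro l h1 h2
      simpa [Matrix.one_apply_ne h2.ne] using hM l j (hij.trans (hc h1))
    rw [Matrix.one_apply_ne h.ne, Matrix.of_apply, polyRow_of_lt M h, hM0 i le_rfl h,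
      Finset.sum_eq_zero, add_zero, polyPart_zero, neg_zero]
    intro l _
    split_ifs with hl
    · rw [hM0 l hl.1.le hl.2, mul_zero]
    · rfl
  · rw [hP.1, Matrix.one_apply_eq]
  · rw [hP.2 i j h, Matrix.one_apply_ne h.ne']

theorem exists_memNnegPoly_mul {m : ℕ} {M : Matrix (Fin m) (Fin m) K} (hM : IsLowerUni M) :
    ∃ P, MemNnegPoly P ∧ MemN1neg (M * P) := by
  have hM' := isUpperUni_transpose.2 hM
  refine ⟨(Matrix.of (polyRow Mᵀ))ᵀ,
    ⟨isLowerUni_transpose.2 (isUpperUni_polyRow _), fun i j => memPoly_polyRow _ j i⟩, ?_⟩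
  have h := memN1_polyRow_mul hM'
  have h' : M * (Matrix.of (polyRow Mᵀ))ᵀ = (Matrix.of (polyRow Mᵀ) * Mᵀ)ᵀ := by
    rw [Matrix.transpose_mul, Matrix.transpose_transpose]
  rw [h']
  exact ⟨isLowerUni_transpose.2 h.1, fun i j hij => h.2 j i hij.symm⟩

/-! ### Gauss decomposition of matrices congruent to the identity -/

theorem memN1_iff {m : ℕ} {X : Matrix (Fin m) (Fin m) K} :
    MemN1 X ↔ IsUpperUni X ∧ ∀ i j : Fin m, i ≠ j → X i j ∈ filt 1 := by
  simp only [MemN1, memO1_iff_mem_filt]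

theorem memT1_diagonal {m : ℕ} {d : Fin m → K} (hd : ∀ i, d i - 1 ∈ filt 1) :
    MemT1 (Matrix.diagonal d) := by
  refine ⟨fun i j hij => Matrix.diagonal_apply_ne _ hij, fun i => ?_⟩
  rw [memO1_iff_mem_filt, Matrix.diagonal_apply_eq]
  exact hd i

theorem MemT1.exists_diagonal {m : ℕ} {h : Matrix (Fin m) (Fin m) K} (hh : MemT1 h) :
    ∃ d : Fin m → K, (∀ i, d i - 1 ∈ filt 1) ∧ h = Matrix.diagonal d := by
  refine ⟨fun i => h i i, fun i => memO1_iff_mem_filt.1 (hh.2 i), ?_⟩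
  ext i j : 1
  by_cases hij : i = j
  · rw [hij, Matrix.diagonal_apply_eq]
  · rw [Matrix.diagonal_apply_ne _ hij, hh.1 i j hij]

/-- A bordered square matrix. -/
def bordered {m : ℕ} (X : Matrix (Fin m) (Fin m) K) (v w : Fin m → K) (q : K) :
    Matrix (Fin (m + 1)) (Fin (m + 1)) K :=
  Matrix.of fun i j => Fin.lastCases (Fin.lastCases q w j)
    (fun i => Fin.lastCases (v i) (fun j => X i j) j) i

section Bordered

variable {m : ℕ} (X : Matrix (Fin m) (Fin m) K) (v w : Fin m → K) (q : K)

@[simp] theorem bordered_last_last :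
    bordered X v w q (Fin.last m) (Fin.last m) = q := by
  simp [bordered]

@[simp] theorem bordered_last_castSucc (j : Fin m) :
    bordered X v w q (Fin.last m) j.castSucc = w j := by
  simp [bordered]

@[simp] theorem bordered_castSucc_last (i : Fin m) :
    bordered X v w q i.castSucc (Fin.last m) = v i := by
  simp [bordered]

@[simp] theorem bordered_castSucc_castSucc (i j : Fin m) :
    bordered X v w q i.castSucc j.castSucc = X i j := by
  simp [bordered]

end Bordered

theorem memN1_bordered {m : ℕ} {X : Matrix (Fin m) (Fin m) K} {v : Fin m → K}
    (hX : MemN1 X) (hv : ∀ i, v i ∈ filt 1) : MemN1 (bordered X v 0 1) := by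
  rw [memN1_iff] at *
  refine ⟨⟨?_, ?_⟩, ?_⟩
  · refine Fin.lastCases ?_ fun i => ?_
    · simp
    · simpa using hX.1.1 i
  · refine Fin.lastCases (Fin.lastCases ?_ fun j => ?_) fun i => Fin.lastCases ?_ fun j => ?_
    · simp
    · simp
    · intro h
      exact absurd h (Fin.castSucc_lt_last i).not_gt
    · simpa using hX.1.2 i j
  · refine Fin.lastCases (Fin.lastCases ?_ fun j => ?_) fun i => Fin.lastCases ?_ fun j => ?_
    · simp
    · simp [zero_mem]
    · simp [hv]
    · simpa using hX.2 i j

theorem memN1neg_bordered {m : ℕ} {X : Matrix (Fin m) (Fin m) K} {w : Fin m → K}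
    (hX : MemN1neg X) (hw : ∀ i, w i ∈ filt 1) : MemN1neg (bordered X 0 w 1) := by
  have h : (bordered X 0 w 1)ᵀ = bordered Xᵀ w 0 1 := by
    ext i j : 1
    revert i j
    refine Fin.lastCases (Fin.lastCases ?_ fun j => ?_) fun i => Fin.lastCases ?_ fun j => ?_ <;>
      simp
  have hX' : MemN1 Xᵀ := ⟨isUpperUni_transpose.2 hX.1, fun i j hij => hX.2 j i hij.symm⟩
  have h1 := memN1_bordered hX' hw
  rw [← h] at h1
  exact ⟨isUpperUni_transpose.1 h1.1, fun i j hij => h1.2 j i hij.symm⟩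

/-- A matrix congruent to the identity modulo `t⁻¹` has a Gauss decomposition. -/
theorem exists_gauss_of_sub_one_mem (m : ℕ) (C : Matrix (Fin m) (Fin m) K)
    (hC : ∀ i j, (C - 1) i j ∈ filt 1) :
    ∃ (a l : Matrix (Fin m) (Fin m) K) (d : Fin m → K),
      MemN1 a ∧ MemN1neg l ∧ (∀ i, d i - 1 ∈ filt 1) ∧ C = a * Matrix.diagonal d * l := by
  induction m with
  | zero =>
    exact ⟨1, 1, 1, ⟨⟨fun i => i.elim0, fun i => i.elim0⟩, fun i => i.elim0⟩,
      ⟨⟨fun i => i.elim0, fun i => i.elim0⟩, fun i => i.elim0⟩, fun i => i.elim0,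
      Subsingleton.elim _ _⟩
  | succ m ih =>
    set q := C (Fin.last m) (Fin.last m) with hqdef
    have hq : q - 1 ∈ filt 1 := by
      simpa using hC (Fin.last m) (Fin.last m)
    have hq0 : q ≠ 0 := ne_zero_of_sub_one_mem hq
    have hqi := inv_mem_filt_zero hq
    have hv : ∀ i : Fin m, C i.castSucc (Fin.last m) ∈ filt 1 := fun i => by
      simpa [Matrix.one_apply_ne (Fin.castSucc_lt_last i).ne] using hC i.castSucc (Fin.last m)
    have hw : ∀ j : Fin m, C (Fin.last m) j.castSucc ∈ filt 1 := fun j => by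
      simpa [Matrix.one_apply_ne (Fin.castSucc_lt_last j).ne'] using hC (Fin.last m) j.castSucc
    have hvq := fun i => mul_mem_filt_one_left (hv i) hqi
    have hwq := fun j => mul_mem_filt_one_right hqi (hw j)
    obtain ⟨a, l, d, ha, hl, hd, hS⟩ := ih
      (Matrix.of fun i j => C i.castSucc j.castSucc -
        C i.castSucc (Fin.last m) * q⁻¹ * C (Fin.last m) j.castSucc) (by
        intro i j
        have h1 := sub_mem (hC i.castSucc j.castSucc)
          (mul_mem_filt_one_left (hvq i) (filt_anti zero_le_one (hw j)))
        have h2 : (1 : Matrix (Fin (m + 1)) (Fin (m + 1)) K) i.castSucc j.castSucc =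
            (1 : Matrix (Fin m) (Fin m) K) i j := by
          simp [Matrix.one_apply]
        convert h1 using 1
        rw [Matrix.sub_apply, Matrix.sub_apply, h2, Matrix.of_apply]
        ring)
    refine ⟨bordered a (fun i => C i.castSucc (Fin.last m) * q⁻¹) 0 1,
      bordered l 0 (fun j => q⁻¹ * C (Fin.last m) j.castSucc) 1,
      Fin.lastCases q d, memN1_bordered ha hvq, memN1neg_bordered hl hwq, ?_, ?_⟩
    · refine Fin.lastCases ?_ fun i => ?_
      · simpa using hq
      · simpa using hd i
    · have hS' : ∀ i j, ∑ x, a i x * d x * l x j = C i.castSucc j.castSucc -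
          C i.castSucc (Fin.last m) * q⁻¹ * C (Fin.last m) j.castSucc := by
        intro i j
        have := congrFun (congrFun hS i) j
        rw [Matrix.of_apply, Matrix.mul_apply] at this
        rw [this]
        exact Finset.sum_congr rfl fun x _ => by rw [Matrix.mul_diagonal]
      ext i j : 1
      revert i j
      refine Fin.lastCases (Fin.lastCases ?_ fun j => ?_) fun i => Fin.lastCases ?_ fun j => ?_ <;>
        rw [Matrix.mul_apply, Fin.sum_univ_castSucc] <;>
        simp [Matrix.mul_diagonal, hS', ← hqdef, hq0]
      field_simp
      ring

/-! ### The block embedding -/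

/-- The inclusion of the block `s, …, s + k` into the indices below `n`. -/
def blockIncl {n s k : ℕ} (hs : s + k < n) (a : Fin (k + 1)) : Fin n :=
  ⟨s + a, by omega⟩

/-- The grading of the indices whose only nontrivial level is the block `s, …, s + k`. -/
def blockGrading (n s k : ℕ) (i : Fin n) : ℕ :=
  if s ≤ (i : ℕ) ∧ (i : ℕ) ≤ s + k then s else i

theorem monotone_blockGrading (n s k : ℕ) : Monotone (blockGrading n s k) := by
  intro i j hij
  have : (i : ℕ) ≤ j := hij
  unfold blockGrading
  split_ifs <;> omega

section Block

variable {n s k : ℕ}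

theorem blockIncl_injective (hs : s + k < n) : Function.Injective (blockIncl hs) := by
  intro a b hab
  simpa [blockIncl, Fin.ext_iff] using hab

theorem exists_blockIncl_eq (hs : s + k < n) {i : Fin n}
    (hi : s ≤ (i : ℕ) ∧ (i : ℕ) ≤ s + k) : ∃ a, blockIncl hs a = i :=
  ⟨⟨(i : ℕ) - s, by omega⟩, Fin.ext (by simp only [blockIncl]; omega)⟩

theorem blockEmbed_blockIncl (hs : s + k < n) (A : Matrix (Fin (k + 1)) (Fin (k + 1)) K)
    (a b : Fin (k + 1)) :
    blockEmbed n (s + 1) k A (blockIncl hs a) (blockIncl hs b) = A a b := by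
  have ha := a.isLt
  have hb := b.isLt
  unfold blockEmbed
  rw [dif_pos (by simp only [blockIncl]; omega)]
  congr 1 <;> ext <;> simp [blockIncl]

theorem blockEmbed_of_not_left (A : Matrix (Fin (k + 1)) (Fin (k + 1)) K) {i : Fin n}
    (hi : ¬ (s ≤ (i : ℕ) ∧ (i : ℕ) ≤ s + k)) (j : Fin n) :
    blockEmbed n (s + 1) k A i j = (1 : Matrix (Fin n) (Fin n) K) i j := by
  unfold blockEmbed
  rw [dif_neg (by rw [Nat.add_sub_cancel]; tauto), Matrix.one_apply]

theorem blockEmbed_of_not_right (A : Matrix (Fin (k + 1)) (Fin (k + 1)) K) (i : Fin n)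
    {j : Fin n} (hj : ¬ (s ≤ (j : ℕ) ∧ (j : ℕ) ≤ s + k)) :
    blockEmbed n (s + 1) k A i j = (1 : Matrix (Fin n) (Fin n) K) i j := by
  unfold blockEmbed
  rw [dif_neg (by rw [Nat.add_sub_cancel]; tauto), Matrix.one_apply]

/-- Entrywise case analysis for block matrices. -/
theorem block_cases (hs : s + k < n) {p : Fin n → Fin n → Prop}
    (hin : ∀ a b, p (blockIncl hs a) (blockIncl hs b))
    (hl : ∀ i j : Fin n, ¬ (s ≤ (i : ℕ) ∧ (i : ℕ) ≤ s + k) → p i j)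
    (hr : ∀ i j : Fin n, ¬ (s ≤ (j : ℕ) ∧ (j : ℕ) ≤ s + k) → p i j) (i j : Fin n) : p i j := by
  by_cases hi : s ≤ (i : ℕ) ∧ (i : ℕ) ≤ s + k
  · by_cases hj : s ≤ (j : ℕ) ∧ (j : ℕ) ≤ s + k
    · obtain ⟨a, rfl⟩ := exists_blockIncl_eq hs hi
      obtain ⟨b, rfl⟩ := exists_blockIncl_eq hs hj
      exact hin a b
    · exact hr i j hj
  · exact hl i j hi

theorem blockEmbed_mul (hs : s + k < n) (A B : Matrix (Fin (k + 1)) (Fin (k + 1)) K) :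
    blockEmbed n (s + 1) k (A * B) = blockEmbed n (s + 1) k A * blockEmbed n (s + 1) k B := by
  ext i j : 1
  refine block_cases hs (p := fun i j => blockEmbed n (s + 1) k (A * B) i j =
    (blockEmbed n (s + 1) k A * blockEmbed n (s + 1) k B) i j) ?_ ?_ ?_ i j
  · intro a b
    rw [blockEmbed_blockIncl, Matrix.mul_apply, Matrix.mul_apply]
    refine Fintype.sum_of_injective (blockIncl hs) (blockIncl_injective hs) _ _ ?_ ?_
    · intro l hl
      have hl' : ¬ (s ≤ (l : ℕ) ∧ (l : ℕ) ≤ s + k) := fun h => hl (exists_blockIncl_eq hs h)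
      rw [blockEmbed_of_not_left B hl', Matrix.one_apply_ne, mul_zero]
      rintro rfl
      exact hl ⟨b, rfl⟩
    · intro c
      rw [blockEmbed_blockIncl, blockEmbed_blockIncl]
  · intro i j hi
    rw [blockEmbed_of_not_left _ hi, Matrix.mul_apply, Finset.sum_eq_single i,
      blockEmbed_of_not_left _ hi, blockEmbed_of_not_left _ hi, Matrix.one_apply_eq, one_mul]
    · intro l _ hl
      rw [blockEmbed_of_not_left _ hi, Matrix.one_apply_ne hl.symm, zero_mul]
    · simp
  · intro i j hj
    rw [blockEmbed_of_not_right _ _ hj, Matrix.mul_apply, Finset.sum_eq_single j,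
      blockEmbed_of_not_right _ _ hj, blockEmbed_of_not_right _ _ hj, Matrix.one_apply_eq, mul_one]
    · intro l _ hl
      rw [blockEmbed_of_not_right _ l hj, Matrix.one_apply_ne hl, mul_zero]
    · simp

theorem blockEmbed_diagonal (hs : s + k < n) (d : Fin (k + 1) → K) :
    blockEmbed n (s + 1) k (Matrix.diagonal d) = Matrix.diagonal fun i : Fin n =>
      if h : s ≤ (i : ℕ) ∧ (i : ℕ) ≤ s + k then d ⟨(i : ℕ) - s, by omega⟩ else 1 := by
  ext i j : 1
  refine block_cases hs (p := fun i j => blockEmbed n (s + 1) k (Matrix.diagonal d) i j =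
    (Matrix.diagonal fun i : Fin n => if h : s ≤ (i : ℕ) ∧ (i : ℕ) ≤ s + k then
      d ⟨(i : ℕ) - s, by omega⟩ else 1) i j) ?_ ?_ ?_ i j
  · intro a b
    rw [blockEmbed_blockIncl]
    by_cases hab : a = b
    · have hb := b.isLt
      rw [hab, Matrix.diagonal_apply_eq, Matrix.diagonal_apply_eq,
        dif_pos (by simp only [blockIncl]; omega)]
      simp [blockIncl]
    · rw [Matrix.diagonal_apply_ne _ hab,
        Matrix.diagonal_apply_ne _ fun h => hab (blockIncl_injective hs h)]
  · intro i j hi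
    rw [blockEmbed_of_not_left _ hi, Matrix.one_apply, Matrix.diagonal_apply, dif_neg hi]
  · intro i j hj
    rw [blockEmbed_of_not_right _ _ hj, Matrix.one_apply, Matrix.diagonal_apply]
    by_cases hij : i = j
    · rw [if_pos hij, if_pos hij, dif_neg (hij ▸ hj)]
    · rw [if_neg hij, if_neg hij]

theorem blockEmbed_one (hs : s + k < n) :
    blockEmbed n (s + 1) k (1 : Matrix (Fin (k + 1)) (Fin (k + 1)) K) = 1 := by
  rw [← Matrix.diagonal_one, blockEmbed_diagonal hs, ← Matrix.diagonal_one]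
  congr 1
  ext i : 1
  simp

theorem graded_blockEmbed (hs : s + k < n) (A : Matrix (Fin (k + 1)) (Fin (k + 1)) K) :
    Graded (blockGrading n s k) (blockEmbed n (s + 1) k A) := by
  refine block_cases hs ?_ ?_ ?_
  · intro a b h
    have ha := a.isLt
    have hb := b.isLt
    refine absurd ?_ h
    unfold blockGrading blockIncl
    rw [if_pos (by dsimp only; omega), if_pos (by dsimp only; omega)]
  · intro i j hi h
    rw [blockEmbed_of_not_left _ hi, Matrix.one_apply_ne]
    exact fun hij => h (congrArg _ hij)
  · intro i j hj h
    rw [blockEmbed_of_not_right _ _ hj, Matrix.one_apply_ne]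
    exact fun hij => h (congrArg _ hij)

theorem isLowerUni_blockEmbed (hs : s + k < n) {A : Matrix (Fin (k + 1)) (Fin (k + 1)) K}
    (hA : IsLowerUni A) : IsLowerUni (blockEmbed n (s + 1) k A) := by
  constructor
  · intro i
    by_cases hi : s ≤ (i : ℕ) ∧ (i : ℕ) ≤ s + k
    · obtain ⟨a, rfl⟩ := exists_blockIncl_eq hs hi
      rw [blockEmbed_blockIncl, hA.1]
    · rw [blockEmbed_of_not_left _ hi, Matrix.one_apply_eq]
  · refine block_cases hs ?_ ?_ ?_
    · intro a b h
      rw [blockEmbed_blockIncl]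
      exact hA.2 a b (by simpa [blockIncl] using h)
    · intro i j hi h
      rw [blockEmbed_of_not_left _ hi, Matrix.one_apply_ne h.ne]
    · intro i j hj h
      rw [blockEmbed_of_not_right _ _ hj, Matrix.one_apply_ne h.ne]

theorem memN1_blockEmbed (hs : s + k < n) {A : Matrix (Fin (k + 1)) (Fin (k + 1)) K}
    (hA : MemN1 A) : MemN1 (blockEmbed n (s + 1) k A) := by
  rw [memN1_iff] at *
  refine ⟨⟨?_, ?_⟩, ?_⟩
  · intro i
    by_cases hi : s ≤ (i : ℕ) ∧ (i : ℕ) ≤ s + k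
    · obtain ⟨a, rfl⟩ := exists_blockIncl_eq hs hi
      rw [blockEmbed_blockIncl, hA.1.1]
    · rw [blockEmbed_of_not_left _ hi, Matrix.one_apply_eq]
  · refine block_cases hs ?_ ?_ ?_
    · intro a b h
      rw [blockEmbed_blockIncl]
      exact hA.1.2 a b (by simpa [blockIncl] using h)
    · intro i j hi h
      rw [blockEmbed_of_not_left _ hi, Matrix.one_apply_ne h.ne']
    · intro i j hj h
      rw [blockEmbed_of_not_right _ _ hj, Matrix.one_apply_ne h.ne']
  · refine block_cases hs ?_ ?_ ?_
    · intro a b h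
      rw [blockEmbed_blockIncl]
      exact hA.2 a b fun hab => h (congrArg _ hab)
    · intro i j hi h
      rw [blockEmbed_of_not_left _ hi, Matrix.one_apply_ne h]
      exact zero_mem _
    · intro i j hj h
      rw [blockEmbed_of_not_right _ _ hj, Matrix.one_apply_ne h]
      exact zero_mem _

theorem lt_of_blockGrading_le {i j : Fin n} (h : blockGrading n s k j ≤ blockGrading n s k i)
    (hij : i ≠ j)
    (hb : ¬ ((s ≤ (i : ℕ) ∧ (i : ℕ) ≤ s + k) ∧ (s ≤ (j : ℕ) ∧ (j : ℕ) ≤ s + k))) : j < i := by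
  have hne : (i : ℕ) ≠ j := fun h => hij (Fin.ext h)
  rw [Fin.lt_def]
  unfold blockGrading at h
  split_ifs at h <;> omega

theorem memNalphaK_iff {M : Matrix (Fin n) (Fin n) K} :
    MemNalphaK n (s + 1) k M ↔ StrictUpper (blockGrading n s k) (M - 1) := by
  constructor
  · rintro ⟨h1, h2⟩ i j hij
    rw [Matrix.sub_apply, sub_eq_zero]
    by_cases he : i = j
    · rw [he, h1.1, Matrix.one_apply_eq]
    by_cases hb : (s ≤ (i : ℕ) ∧ (i : ℕ) ≤ s + k) ∧ (s ≤ (j : ℕ) ∧ (j : ℕ) ≤ s + k)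
    · rw [h2 i j hb.1.1 hb.1.2 hb.2.1 hb.2.2, Matrix.one_apply]
    · rw [h1.2 i j (lt_of_blockGrading_le hij he hb), Matrix.one_apply_ne he]
  · intro h
    have h' : ∀ i j, blockGrading n s k j ≤ blockGrading n s k i →
        M i j = (1 : Matrix (Fin n) (Fin n) K) i j := fun i j hij => sub_eq_zero.1 (h i j hij)
    refine ⟨⟨fun i => ?_, fun i j hij => ?_⟩, fun i j hi hi' hj hj' => ?_⟩
    · rw [h' i i le_rfl, Matrix.one_apply_eq]
    · rw [h' i j (monotone_blockGrading n s k hij.le), Matrix.one_apply_ne hij.ne']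
    · rw [h' i j, Matrix.one_apply]
      rw [Nat.add_sub_cancel] at hi hi' hj hj'
      unfold blockGrading
      rw [if_pos ⟨hj, hj'⟩, if_pos ⟨hi, hi'⟩]

/-- A unitriangular matrix agrees with its diagonal block up to an element of the radical. -/
theorem strictUpper_sub_blockEmbed (hs : s + k < n) {U : Matrix (Fin n) (Fin n) K}
    (hU : IsUpperUni U) : StrictUpper (blockGrading n s k)
      (U - blockEmbed n (s + 1) k (U.submatrix (blockIncl hs) (blockIncl hs))) := by
  have key : ∀ i j : Fin n, blockGrading n s k j ≤ blockGrading n s k i →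
      ¬ ((s ≤ (i : ℕ) ∧ (i : ℕ) ≤ s + k) ∧ (s ≤ (j : ℕ) ∧ (j : ℕ) ≤ s + k)) →
      U i j = (1 : Matrix (Fin n) (Fin n) K) i j := by
    intro i j hij hb
    by_cases he : i = j
    · rw [he, hU.1, Matrix.one_apply_eq]
    · rw [hU.2 i j (lt_of_blockGrading_le hij he hb), Matrix.one_apply_ne he]
  refine block_cases hs ?_ ?_ ?_
  · intro a b _
    rw [Matrix.sub_apply, blockEmbed_blockIncl, Matrix.submatrix_apply, sub_self]
  · intro i j hi h
    rw [Matrix.sub_apply, blockEmbed_of_not_left _ hi, key i j h (by tauto), sub_self]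
  · intro i j hj h
    rw [Matrix.sub_apply, blockEmbed_of_not_right _ _ hj, key i j h (by tauto), sub_self]

theorem memN1_submatrix_blockIncl (hs : s + k < n) {U : Matrix (Fin n) (Fin n) K}
    (hU : MemN1 U) : MemN1 (U.submatrix (blockIncl hs) (blockIncl hs)) := by
  refine ⟨⟨fun a => hU.1.1 _, fun a b hab => hU.1.2 _ _ ?_⟩, fun a b hab => hU.2 _ _ ?_⟩
  · simpa [blockIncl] using hab
  · exact fun h => hab (blockIncl_injective hs h)

end Block

/-! ### The Gauss decomposition of `y(p,e,b,g)⁻¹ * A` -/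

theorem tPow_add {m : ℕ} (ν ν' : Fin m → ℤ) :
    (tPow (fun i => ν i + ν' i) : Matrix (Fin m) (Fin m) K) = tPow ν * tPow ν' := by
  rw [tPow, tPow, tPow, Matrix.diagonal_mul_diagonal]
  congr 1
  ext i : 1
  exact zpow_add₀ tK_ne_zero _ _

/-- The coweight `α` on the block of size `m + 2`. -/
def endsCo (m : ℕ) : Fin (m + 2) → ℤ :=
  fun i => if (i : ℕ) = 0 then 1 else if (i : ℕ) = m + 1 then -1 else 0

/-- The inverse of the matrix `y(p,e,b,g)`. -/
def yinv (m : ℕ) (p e : ℂ) (b g : Fin m → ℂ) : Matrix (Fin (m + 2)) (Fin (m + 2)) K :=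
  Matrix.of fun i => Fin.cases
    (fun j => Fin.cases (tK - Cc p)
      (fun j => Fin.lastCases (Cc (-e)) (fun j => Cc (-(e * g j.rev))) j) j)
    (fun i => Fin.lastCases (fun j => if j = 0 then Cc e⁻¹ else 0)
      (fun i j => if j = 0 then Cc (-(b i.rev / e)) else if j = i.castSucc.succ then 1 else 0) i) i

/-- Case analysis on first, last and middle indices. -/
theorem ends_cases {m : ℕ} {p : Fin (m + 2) → Prop} (h0 : p 0) (hl : p (Fin.last m).succ)
    (hm : ∀ i : Fin m, p i.castSucc.succ) (i : Fin (m + 2)) : p i :=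
  Fin.cases h0 (Fin.lastCases hl hm) i

theorem sum_ends {m : ℕ} (f : Fin (m + 2) → K) :
    ∑ i, f i = f 0 + ((∑ i : Fin m, f i.castSucc.succ) + f (Fin.last m).succ) := by
  rw [Fin.sum_univ_succ, Fin.sum_univ_castSucc]

section YInv

variable {m : ℕ} (p e : ℂ) (b g : Fin m → ℂ)

theorem yinv_mul_zero (A : Matrix (Fin (m + 2)) (Fin (m + 2)) K) (j : Fin (m + 2)) :
    (yinv m p e b g * A) 0 j = (tK - Cc p) * A 0 j +
      ((∑ i : Fin m, Cc (-(e * g i.rev)) * A i.castSucc.succ j) +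
        Cc (-e) * A (Fin.last m).succ j) := by
  rw [Matrix.mul_apply, sum_ends]
  simp only [yinv, Matrix.of_apply, Fin.cases_zero, Fin.cases_succ, Fin.lastCases_last,
    Fin.lastCases_castSucc]

theorem yinv_mul_last (A : Matrix (Fin (m + 2)) (Fin (m + 2)) K) (j : Fin (m + 2)) :
    (yinv m p e b g * A) (Fin.last m).succ j = Cc e⁻¹ * A 0 j := by
  rw [Matrix.mul_apply, sum_ends]
  simp [yinv, -Fin.succ_last]

theorem yinv_mul_mid (A : Matrix (Fin (m + 2)) (Fin (m + 2)) K) (i : Fin m)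
    (j : Fin (m + 2)) : (yinv m p e b g * A) i.castSucc.succ j =
      Cc (-(b i.rev / e)) * A 0 j + A i.castSucc.succ j := by
  have h : ∀ l : Fin m, l.castSucc.succ = i.castSucc.succ ↔ l = i := fun l => by
    rw [Fin.succ_inj, Fin.castSucc_inj]
  have h' : (Fin.last m).succ ≠ i.castSucc.succ := fun h =>
    (Fin.castSucc_lt_last i).ne' (Fin.succ_inj.1 h)
  rw [Matrix.mul_apply, sum_ends]
  simp only [yinv, Matrix.of_apply, Fin.cases_succ, Fin.lastCases_castSucc, if_true,
    Fin.succ_ne_zero, if_false, h, h', ite_mul, one_mul, zero_mul, Finset.sum_ite_eq',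
    Finset.mem_univ, add_zero]

end YInv

theorem Cc_add (a b : ℂ) : Cc (a + b) = Cc a + Cc b := map_add _ _ _

theorem Cc_mul (a b : ℂ) : Cc (a * b) = Cc a * Cc b := map_mul _ _ _

theorem Cc_neg (a : ℂ) : Cc (-a) = -Cc a := map_neg _ _

theorem Cc_zero : Cc 0 = 0 := map_zero _

theorem Cc_one : Cc 1 = 1 := map_one _

theorem Cc_sum {ι : Type*} (s : Finset ι) (f : ι → ℂ) :
    Cc (∑ i ∈ s, f i) = ∑ i ∈ s, Cc (f i) := map_sum _ _ _

section YMat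

variable {m : ℕ} (p e : ℂ) (b g : Fin m → ℂ)

theorem ymat_zero_last : ymat (m + 1) p e b g 0 (Fin.last m).succ = Cc e := by
  simp [ymat]

theorem ymat_zero_zero : ymat (m + 1) p e b g 0 0 = 0 := by
  simp [ymat]

theorem ymat_zero_mid (j : Fin m) : ymat (m + 1) p e b g 0 j.castSucc.succ = 0 := by
  simp [ymat, j.isLt.ne]

theorem ymat_last_zero : ymat (m + 1) p e b g (Fin.last m).succ 0 = Cc (-e⁻¹) := by
  simp [ymat]

theorem ymat_last_last : ymat (m + 1) p e b g (Fin.last m).succ (Fin.last m).succ =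
    tK - Cc (p + ∑ l : Fin m, b l * g l) := by
  simp [ymat]

theorem ymat_last_mid (j : Fin m) :
    ymat (m + 1) p e b g (Fin.last m).succ j.castSucc.succ = Cc (-(g j.rev)) := by
  simp only [ymat, Fin.val_succ, Fin.val_last, Fin.val_castSucc]
  rw [dif_neg (by omega), dif_pos trivial, dif_neg (by omega), dif_neg (by omega)]
  congr 3
  ext
  simp only [Fin.val_rev]
  omega

theorem ymat_mid_zero (i : Fin m) : ymat (m + 1) p e b g i.castSucc.succ 0 = 0 := by
  simp [ymat, i.isLt.ne]

theorem ymat_mid_last (i : Fin m) :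
    ymat (m + 1) p e b g i.castSucc.succ (Fin.last m).succ = Cc (b i.rev) := by
  simp only [ymat, Fin.val_succ, Fin.val_last, Fin.val_castSucc]
  rw [dif_neg (by omega), dif_neg (by omega), dif_neg (by omega), dif_pos trivial]
  congr 2
  ext
  simp only [Fin.val_rev]
  omega

theorem ymat_mid_mid (i j : Fin m) :
    ymat (m + 1) p e b g i.castSucc.succ j.castSucc.succ = if i = j then 1 else 0 := by
  simp [ymat, i.isLt.ne, j.isLt.ne, Fin.ext_iff, eq_comm]

theorem yinv_mul_ymat (he : e ≠ 0) : yinv m p e b g * ymat (m + 1) p e b g = 1 := by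
  have he1 : Cc e⁻¹ * Cc e = 1 := by rw [← Cc_mul, inv_mul_cancel₀ he, Cc_one]
  have he2 : Cc e * Cc e⁻¹ = 1 := by rw [mul_comm, he1]
  have hm : ∀ i : Fin m, (Fin.last m).succ ≠ i.castSucc.succ := fun i h =>
    (Fin.castSucc_lt_last i).ne' (Fin.succ_inj.1 h)
  have hrev : ∑ i : Fin m, b i.rev * g i.rev = ∑ i : Fin m, b i * g i :=
    Equiv.sum_comp Fin.revPerm fun i => b i * g i
  ext i j : 1
  revert i j
  refine ends_cases (fun j => ?_) (fun j => ?_) (fun i j => ?_)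
  · rw [yinv_mul_zero]
    revert j
    refine ends_cases ?_ ?_ fun j => ?_
    · simp [ymat_zero_zero, ymat_mid_zero, ymat_last_zero, Cc_neg, -Fin.succ_last]
      linear_combination he2
    · rw [ymat_zero_last, ymat_last_last, Matrix.one_apply_ne (Fin.succ_ne_zero _).symm]
      simp only [ymat_mid_last, ← Cc_mul, ← Cc_sum]
      have h : ∑ i : Fin m, -(e * g i.rev) * b i.rev = -(e * ∑ i : Fin m, b i * g i) := by
        rw [← hrev, Finset.mul_sum, ← Finset.sum_neg_distrib]
        exact Finset.sum_congr rfl fun i _ => by ring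
      rw [h]
      simp only [Cc_neg, Cc_mul, Cc_add]
      ring
    · rw [ymat_zero_mid, ymat_last_mid, Matrix.one_apply_ne (Fin.succ_ne_zero _).symm]
      simp only [ymat_mid_mid, mul_ite, mul_one, mul_zero, Finset.sum_ite_eq', Finset.mem_univ,
        if_true, Cc_neg, Cc_mul]
      ring
  · rw [yinv_mul_last]
    revert j
    refine ends_cases ?_ ?_ fun j => ?_
    · rw [ymat_zero_zero, mul_zero, Matrix.one_apply_ne (Fin.succ_ne_zero _)]
    · rw [ymat_zero_last, he1, Matrix.one_apply_eq]
    · rw [ymat_zero_mid, mul_zero, Matrix.one_apply_ne (hm j)]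
  · rw [yinv_mul_mid]
    revert j
    refine ends_cases ?_ ?_ fun j => ?_
    · rw [ymat_zero_zero, ymat_mid_zero, mul_zero, add_zero,
        Matrix.one_apply_ne (Fin.succ_ne_zero _)]
    · rw [ymat_zero_last, ymat_mid_last, Matrix.one_apply_ne (hm i).symm, ← Cc_mul, ← Cc_add]
      rw [neg_mul, div_mul_cancel₀ _ he, neg_add_cancel, Cc_zero]
    · rw [ymat_zero_mid, ymat_mid_mid, mul_zero, zero_add, Matrix.one_apply]
      simp [Fin.succ_inj, Fin.castSucc_inj]

end YMat

/-- If the parameters of `y(p,e,b,g)` are the leading coefficients of `A`, then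
`y(p,e,b,g)⁻¹ * A * t^{-α}` is congruent to the identity modulo `t⁻¹`. -/
theorem yinv_mul_sub_one_mem {m : ℕ} {A : Matrix (Fin (m + 2)) (Fin (m + 2)) K} (hA : MemN1 A)
    {p e : ℂ} {b g : Fin m → ℂ} (he : e ≠ 0)
    (hAe : (A 0 (Fin.last m).succ).coeff 1 = e)
    (hAb : ∀ i : Fin m, (A i.castSucc.succ (Fin.last m).succ).coeff 1 = b i.rev)
    (hAg : ∀ i : Fin m, (A 0 i.castSucc.succ).coeff 1 = e * g i.rev)
    (hAp : (A 0 (Fin.last m).succ).coeff 2 = e * (p + ∑ i, b i * g i)) (i j : Fin (m + 2)) :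
    (yinv m p e b g * A * tPow (-endsCo m) - 1) i j ∈ filt 1 := by
  rw [memN1_iff] at hA
  obtain ⟨⟨hA1, hA0⟩, hAO⟩ := hA
  have hm : ∀ i : Fin m, i.castSucc.succ < (Fin.last m).succ := fun i =>
    Fin.succ_lt_succ_iff.2 (Fin.castSucc_lt_last i)
  have ht0 : tK ^ (-endsCo m) 0 = tK⁻¹ := by simp [endsCo]
  have htl : tK ^ (-endsCo m) (Fin.last m).succ = tK := by simp [endsCo]
  have htm : ∀ i : Fin m, tK ^ (-endsCo m) i.castSucc.succ = 1 := fun i => by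
    simp [endsCo, i.isLt.ne]
  have hrev : ∑ i : Fin m, b i.rev * g i.rev = ∑ i : Fin m, b i * g i :=
    Equiv.sum_comp Fin.revPerm fun i => b i * g i
  have htK : ∀ {f : K}, f ∈ filt 2 → f * tK ∈ filt 1 := by
    intro f hf j hj
    rw [mul_comm, coeff_tK_mul]
    exact hf _ (by omega)
  have hcol : ∀ i : Fin (m + 2), i ≠ (Fin.last m).succ → ∀ j < 1,
      (A i (Fin.last m).succ).coeff j = 0 := fun i hi j hj => hAO _ _ hi j hj
  have hcol0 := hcol 0 (Fin.succ_ne_zero _).symm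
  rw [tPow, Matrix.sub_apply, Matrix.mul_diagonal]
  revert i j
  refine ends_cases (fun j => ?_) (fun j => ?_) (fun i j => ?_)
  · rw [yinv_mul_zero]
    revert j
    refine ends_cases ?_ ?_ fun j => ?_
    · rw [ht0, hA1, hA0 _ _ (Fin.succ_pos _), Matrix.one_apply_eq, Finset.sum_eq_zero]
      · have h := mul_mem_filt_one_right (Cc_mem_filt (-p)) tK_inv_mem_filt
        convert h using 1
        simp only [Cc_neg]
        field_simp [tK_ne_zero]
        ring
      · intro l _
        rw [hA0 _ _ (Fin.succ_pos _), mul_zero]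
    · rw [htl, hA1, Matrix.one_apply_ne (Fin.succ_ne_zero _).symm, sub_zero]
      refine htK fun j hj => ?_
      rw [HahnSeries.coeff_add, HahnSeries.coeff_add, sub_mul, HahnSeries.coeff_sub,
        coeff_tK_mul, coeff_Cc_mul, coeff_Cc_mul, HahnSeries.coeff_sum]
      simp only [coeff_Cc_mul]
      rcases lt_or_ge j 1 with h1 | h1
      · rw [hcol0 j h1, Finset.sum_eq_zero fun i _ => by rw [hcol _ (hm i).ne j h1, mul_zero],
          HahnSeries.coeff_one]
        rcases lt_or_ge j 0 with h0 | h0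
        · rw [hcol0 _ (by omega), if_neg h0.ne]
          ring
        · obtain rfl : j = 0 := by omega
          rw [zero_add, hAe, if_pos rfl]
          ring
      · obtain rfl : j = 1 := by omega
        rw [HahnSeries.coeff_one, if_neg one_ne_zero, show (1 : ℤ) + 1 = 2 by norm_num, hAp, hAe,
          ← hrev, mul_add, Finset.mul_sum]
        simp only [hAb]
        have h : ∑ i : Fin m, -(e * g i.rev) * b i.rev = -∑ i : Fin m, e * (b i.rev * g i.rev) := by
          rw [← Finset.sum_neg_distrib]
          exact Finset.sum_congr rfl fun i _ => by ring
        rw [h]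
        ring
    · rw [htm, mul_one, Matrix.one_apply_ne (Fin.succ_ne_zero _).symm, sub_zero,
        hA0 _ _ (hm j), mul_zero, add_zero]
      have h0j := hAO 0 j.castSucc.succ (Fin.succ_ne_zero _).symm
      have h1 : tK * A 0 j.castSucc.succ - Cc (e * g j.rev) ∈ filt 1 := by
        intro d hd
        rw [HahnSeries.coeff_sub, coeff_tK_mul]
        rcases lt_or_ge d 0 with h0 | h0
        · rw [h0j _ (by omega), Cc_mem_filt _ d h0, sub_zero]
        · obtain rfl : d = 0 := by omega
          rw [zero_add, hAg]
          simp [Cc]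
      have h2 : ∑ i : Fin m, Cc (-(e * g i.rev)) *
          (A i.castSucc.succ j.castSucc.succ - if i = j then 1 else 0) ∈ filt 1 := by
        refine sum_mem fun i _ => mul_mem_filt_one_right (Cc_mem_filt _) ?_
        by_cases hij : i = j
        · rw [hij, hA1, if_pos rfl, sub_self]
          exact zero_mem _
        · rw [if_neg hij, sub_zero]
          exact hAO _ _ fun h => hij (by simpa [Fin.succ_inj, Fin.castSucc_inj] using h)
      have h3 := mul_mem_filt_one_right (Cc_mem_filt p) h0j
      convert add_mem (sub_mem h1 h3) h2 using 1
      simp only [mul_sub, Finset.sum_sub_distrib, mul_ite, mul_one, mul_zero,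
        Finset.sum_ite_eq', Finset.mem_univ, if_true, Cc_neg]
      ring
  · rw [yinv_mul_last]
    revert j
    refine ends_cases ?_ ?_ fun j => ?_
    · rw [ht0, hA1, Matrix.one_apply_ne (Fin.succ_ne_zero _), sub_zero, mul_one]
      exact mul_mem_filt_one_right (Cc_mem_filt _) tK_inv_mem_filt
    · rw [htl, Matrix.one_apply_eq]
      intro d hd
      rw [HahnSeries.coeff_sub, mul_right_comm, mul_comm, mul_left_comm, mul_comm (A _ _),
        mul_left_comm, coeff_tK_mul, coeff_Cc_mul, HahnSeries.coeff_one]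
      rcases lt_or_ge d 0 with h0 | h0
      · rw [hcol0 _ (by omega), if_neg h0.ne]
        ring
      · obtain rfl : d = 0 := by omega
        rw [zero_add, hAe, if_pos rfl, inv_mul_cancel₀ he, sub_self]
    · rw [htm, mul_one, Matrix.one_apply_ne (hm j).ne', sub_zero]
      exact mul_mem_filt_one_right (Cc_mem_filt _) (hAO _ _ (Fin.succ_ne_zero _).symm)
  · rw [yinv_mul_mid]
    revert j
    refine ends_cases ?_ ?_ fun j => ?_
    · rw [ht0, hA1, hA0 _ _ (Fin.succ_pos _), Matrix.one_apply_ne (Fin.succ_ne_zero _), sub_zero,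
        mul_one, add_zero]
      exact mul_mem_filt_one_right (Cc_mem_filt _) tK_inv_mem_filt
    · rw [htl, Matrix.one_apply_ne (hm i).ne, sub_zero]
      refine htK fun d hd => ?_
      rw [HahnSeries.coeff_add, coeff_Cc_mul]
      rcases lt_or_ge d 1 with h1 | h1
      · rw [hcol0 d h1, hcol _ (hm i).ne d h1]
        ring
      · obtain rfl : d = 1 := by omega
        rw [hAe, hAb]
        field_simp
        ring
    · rw [htm, mul_one, add_sub_assoc]
      refine add_mem (mul_mem_filt_one_right (Cc_mem_filt _)
        (hAO _ _ (Fin.succ_ne_zero _).symm)) ?_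
      by_cases hij : i.castSucc.succ = j.castSucc.succ
      · rw [hij, hA1, Matrix.one_apply_eq, sub_self]
        exact zero_mem _
      · rw [Matrix.one_apply_ne hij, sub_zero]
        exact hAO _ _ hij

theorem isLowerUni_tPow_conj {m : ℕ} (ν : Fin m → ℤ) {l : Matrix (Fin m) (Fin m) K}
    (hl : IsLowerUni l) : IsLowerUni (tPow (-ν) * l * tPow ν) :=
  isLowerUni_diagonal_conj (fun i => by
    rw [Pi.neg_apply, _root_.zpow_neg, inv_mul_cancel₀ (zpow_ne_zero _ tK_ne_zero)]) hl

theorem tPow_neg_mul_tPow {m : ℕ} (ν : Fin m → ℤ) :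
    (tPow (-ν) * tPow ν : Matrix (Fin m) (Fin m) K) = 1 := by
  have h : (fun i => (-ν) i + ν i) = (0 : Fin m → ℤ) := by
    ext i
    simp
  rw [← tPow_add, h, tPow]
  simp

theorem tPow_mul_tPow_neg {m : ℕ} (ν : Fin m → ℤ) :
    (tPow ν * tPow (-ν) : Matrix (Fin m) (Fin m) K) = 1 := by
  simpa using tPow_neg_mul_tPow (-ν)

theorem blockEmbed_tPow_endsCo {n s m : ℕ} (hs : s + (m + 1) < n) :
    blockEmbed n (s + 1) (m + 1) (tPow (endsCo m)) = tPow (alphaCo n (s + 1) (s + 1 + m)) := by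
  rw [tPow, blockEmbed_diagonal hs, tPow]
  congr 1
  ext i : 1
  split_ifs with hi
  · congr 1
    simp only [endsCo, alphaCo]
    split_ifs <;> omega
  · have h0 : alphaCo n (s + 1) (s + 1 + m) i = 0 := by
      unfold alphaCo
      rw [if_neg (by omega), if_neg (by omega)]
    rw [h0, zpow_zero]

/-- The part `N(K)^α₁ · t^{μ+α} · T₁[[t⁻¹]] · N₋(K)` of the decomposition, for a block `Q`
having a Gauss decomposition. -/
theorem exists_decomposition {n s m : ℕ} (hs : s + (m + 1) < n) (μ : Fin n → ℤ)
    {U h L Z A' : Matrix _ _ K} (hU : IsUpperUni U) (hh : MemT1 h) (hL : IsLowerUni L)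
    {a l : Matrix (Fin (m + 2)) (Fin (m + 2)) K} {d : Fin (m + 2) → K}
    (ha : MemN1 a) (hl : IsLowerUni l) (hd : ∀ i, d i - 1 ∈ filt 1)
    (hA' : A' * U.submatrix (blockIncl hs) (blockIncl hs) = 1)
    (hA : U.submatrix (blockIncl hs) (blockIncl hs) * A' = 1)
    (hZ : Z * U.submatrix (blockIncl hs) (blockIncl hs) * tPow (-endsCo m) =
      a * Matrix.diagonal d * l) :
    ∃ w h' l' : Matrix (Fin n) (Fin n) K,
      MemNKalpha1 n (s + 1) (m + 1) w ∧ MemT1 h' ∧ IsLowerUni l' ∧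
      blockEmbed n (s + 1) (m + 1) Z * (U * h * tPow μ * L) =
        w * tPow (addAlpha n (s + 1) (s + 1 + m) μ) * h' * l' := by
  set A := U.submatrix (blockIncl hs) (blockIncl hs) with hAdef
  obtain ⟨δ, hδ, rfl⟩ := hh.exists_diagonal
  let τ : Matrix (Fin (m + 2)) (Fin (m + 2)) K → Matrix (Fin n) (Fin n) K :=
    blockEmbed n (s + 1) (m + 1)
  have hτ : ∀ X Y, τ (X * Y) = τ X * τ Y := blockEmbed_mul hs
  have hτ1 : τ 1 = 1 := blockEmbed_one hs
  have hV : StrictUpper (blockGrading n s (m + 1)) (τ A' * U - 1) := by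
    have h1 : τ A' * U - 1 = τ A' * (U - τ A) := by rw [mul_sub, ← hτ, hA', hτ1]
    rw [h1]
    exact (strictUpper_sub_blockEmbed hs hU).graded_mul (graded_blockEmbed hs A')
  have hUV : U = τ A * (τ A' * U) := by rw [← mul_assoc, ← hτ, hA, hτ1, one_mul]
  set V := τ A' * U
  set D := Matrix.diagonal d * tPow (endsCo m) with hDdef
  set l₂ := tPow (-endsCo m) * l * tPow (endsCo m) with hl₂def
  have hl₂ : IsLowerUni l₂ := isLowerUni_tPow_conj _ hl
  obtain ⟨l₃, hl₃, hl₃'⟩ := exists_mul_eq_one_of_isLowerUni hl₂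
  have hZA : Z * A = a * (D * l₂) := by
    calc Z * A = Z * A * tPow (-endsCo m) * tPow (endsCo m) := by
          rw [mul_assoc, tPow_neg_mul_tPow, mul_one]
      _ = a * Matrix.diagonal d * (tPow (endsCo m) * tPow (-endsCo m)) * l * tPow (endsCo m) := by
          rw [hZ, tPow_mul_tPow_neg, mul_one]
      _ = a * (D * l₂) := by
          simp only [hDdef, hl₂def, mul_assoc]
  have hdinv : Matrix.diagonal d * Matrix.diagonal (fun i => (d i)⁻¹) = 1 := by
    rw [Matrix.diagonal_mul_diagonal, ← Matrix.diagonal_one]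
    congr 1
    ext i : 1
    exact mul_inv_cancel₀ (ne_zero_of_sub_one_mem (hd i))
  set Q := D * l₂ with hQdef
  set Q' := l₃ * (tPow (-endsCo m) * Matrix.diagonal fun i => (d i)⁻¹) with hQ'def
  have hQQ' : Q * Q' = 1 := by
    calc Q * Q' = Matrix.diagonal d * (tPow (endsCo m) * (l₂ * l₃) * tPow (-endsCo m)) *
          Matrix.diagonal fun i => (d i)⁻¹ := by simp only [hQdef, hQ'def, hDdef, mul_assoc]
      _ = 1 := by rw [hl₃', mul_one, tPow_mul_tPow_neg, mul_one, hdinv]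
  have hQ'Q : Q' * Q = 1 := mul_eq_one_comm.1 hQQ'
  have hW := hV.conj_sub_one (graded_blockEmbed hs Q) (graded_blockEmbed hs Q')
    (show τ Q * τ Q' = 1 by rw [← hτ, hQQ', hτ1])
  set δ' : Fin n → K := fun i => δ i * tK ^ μ i with hδ'def
  have hδμ : Matrix.diagonal δ * tPow μ = Matrix.diagonal δ' := by
    rw [tPow, Matrix.diagonal_mul_diagonal]
  have hδ'0 : ∀ i, δ' i ≠ 0 := fun i =>
    mul_ne_zero (ne_zero_of_sub_one_mem (hδ i)) (zpow_ne_zero _ tK_ne_zero)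
  have hδ'inv : Matrix.diagonal δ' * Matrix.diagonal (fun i => (δ' i)⁻¹) = 1 := by
    rw [Matrix.diagonal_mul_diagonal, ← Matrix.diagonal_one]
    congr 1
    ext i : 1
    exact mul_inv_cancel₀ (hδ'0 i)
  have hl₄ : IsLowerUni (Matrix.diagonal (fun i => (δ' i)⁻¹) * τ l₂ * Matrix.diagonal δ') :=
    isLowerUni_diagonal_conj (fun i => inv_mul_cancel₀ (hδ'0 i)) (isLowerUni_blockEmbed hs hl₂)
  set d' : Fin n → K := fun i => if h : s ≤ (i : ℕ) ∧ (i : ℕ) ≤ s + (m + 1) then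
    d ⟨(i : ℕ) - s, by omega⟩ else 1 with hd'def
  have hd' : ∀ i, d' i - 1 ∈ filt 1 := by
    intro i
    simp only [hd'def]
    split_ifs
    · exact hd _
    · rw [sub_self]
      exact zero_mem _
  have hτd : τ (Matrix.diagonal d) = Matrix.diagonal d' := blockEmbed_diagonal hs d
  have hτt : τ (tPow (endsCo m)) = tPow (alphaCo n (s + 1) (s + 1 + m)) :=
    blockEmbed_tPow_endsCo hs
  have htorus : τ D * Matrix.diagonal δ' = tPow (addAlpha n (s + 1) (s + 1 + m) μ) *
      Matrix.diagonal fun i => d' i * δ i := by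
    rw [hDdef, hτ, hτd, hτt, tPow, tPow, Matrix.diagonal_mul_diagonal,
      Matrix.diagonal_mul_diagonal, Matrix.diagonal_mul_diagonal]
    congr 1
    ext i : 1
    simp only [hδ'def, addAlpha]
    rw [zpow_add₀ tK_ne_zero]
    ring
  refine ⟨τ a * (τ Q * V * τ Q'), Matrix.diagonal fun i => d' i * δ i,
    Matrix.diagonal (fun i => (δ' i)⁻¹) * τ l₂ * Matrix.diagonal δ' * L,
    ⟨a, _, ha, memNalphaK_iff.2 hW, rfl⟩,
    memT1_diagonal fun i => mul_sub_one_mem (hd' i) (hδ i), isLowerUni_mul hl₄ hL, ?_⟩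
  calc τ Z * (U * Matrix.diagonal δ * tPow μ * L)
      = τ Z * U * (Matrix.diagonal δ * tPow μ) * L := by simp only [mul_assoc]
    _ = τ Z * (τ A * V) * Matrix.diagonal δ' * L := by rw [hδμ, ← hUV]
    _ = τ a * τ Q * V * 1 * Matrix.diagonal δ' * L := by
        rw [← mul_assoc (τ Z), ← hτ, hZA, hτ, mul_one]
    _ = τ a * τ Q * V * (τ Q' * τ Q) * Matrix.diagonal δ' * L := by
        rw [← hτ Q', hQ'Q, hτ1]
    _ = τ a * (τ Q * V * τ Q') * (τ D * (1 * τ l₂)) * Matrix.diagonal δ' * L := by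
        rw [one_mul, ← hτ D]
        simp only [hQdef, mul_assoc]
    _ = τ a * (τ Q * V * τ Q') * (τ D * Matrix.diagonal δ') *
          (Matrix.diagonal (fun i => (δ' i)⁻¹) * τ l₂ * Matrix.diagonal δ' * L) := by
        rw [← hδ'inv]
        simp only [mul_assoc]
    _ = _ := by
        rw [htorus]
        simp only [mul_assoc]

/-- A point of `N(K)^α₁ · t^ν · T₁[[t⁻¹]] · N₋(K)` is moved into `Gr_ν` by `N^α[t]` and
`N₋[t]`. -/
theorem exists_isPiOf {n s k : ℕ} (hs : s + k < n) (ν : Fin n → ℤ)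
    {x w h l : Matrix (Fin n) (Fin n) K} (hw : MemNKalpha1 n (s + 1) k w) (hh : MemT1 h)
    (hl : IsLowerUni l) (hx : x = w * tPow ν * h * l) :
    ∃ a c : Matrix (Fin n) (Fin n) K,
      MemNalphaPoly n (s + 1) k a ∧ MemNnegPoly c ∧ IsPiOf ν x (a * x * c) := by
  obtain ⟨A, V, hA, hV, rfl⟩ := hw
  obtain ⟨δ, hδ, rfl⟩ := hh.exists_diagonal
  obtain ⟨A', hA', hAA'⟩ := exists_mul_eq_one_of_isUpperUni hA.1
  have hτ' : blockEmbed n (s + 1) k A' * blockEmbed n (s + 1) k A = 1 := by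
    rw [← blockEmbed_mul hs, hA', blockEmbed_one hs]
  have hτ : blockEmbed n (s + 1) k A * blockEmbed n (s + 1) k A' = 1 := by
    rw [← blockEmbed_mul hs, hAA', blockEmbed_one hs]
  have hW := (memNalphaK_iff.1 hV).conj_sub_one (graded_blockEmbed hs A)
    (graded_blockEmbed hs A') hτ
  set W := blockEmbed n (s + 1) k A * V * blockEmbed n (s + 1) k A' with hWdef
  have hWA : blockEmbed n (s + 1) k A * V = W * blockEmbed n (s + 1) k A := by
    rw [hWdef, mul_assoc, hτ', mul_one]
  have hP : MemNalphaPoly n (s + 1) k (Matrix.of (polyRow W)) :=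
    ⟨memNalphaK_iff.2 (strictUpper_polyRow (monotone_blockGrading n s k) hW),
      memPoly_polyRow W⟩
  obtain ⟨c, hc, hlc⟩ := exists_memNnegPoly_mul hl
  refine ⟨Matrix.of (polyRow W), c, hP, hc, ⟨Matrix.of (polyRow W) * W *
    blockEmbed n (s + 1) k A, Matrix.diagonal δ, l * c, ?_, memT1_diagonal hδ, hlc, ?_⟩,
    _, c, ⟨hP.1.1, hP.2⟩, hc, rfl⟩
  · exact memN1_mul (memN1_polyRow_mul (memNalphaK_iff.2 hW).1) (memN1_blockEmbed hs hA)
  · have hcomm : tPow ν * Matrix.diagonal δ = Matrix.diagonal δ * tPow ν := by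
      rw [tPow, Matrix.diagonal_mul_diagonal, Matrix.diagonal_mul_diagonal]
      congr 1
      ext i : 1
      exact mul_comm _ _
    rw [hx, hWA, mul_assoc _ (tPow ν), hcomm]
    simp only [mul_assoc]

/-- Let `y ∈ Gr_μ` with `Φ_{α,k}(y) ≠ 0`.  Then
`ξ_α(y)⁻¹·y ∈ N(K)^α₁ · t^{μ+α} · T₁[[t⁻¹]] · N₋(K)`; in particular there exist
`a ∈ N^α[t]` and `c ∈ N₋[t]` with `a·ξ_α(y)⁻¹·y·c ∈ Gr_{μ+α}`, so that
`π(ξ_α(y)⁻¹·y) ∈ Gr_{μ+α}` is defined and equals `a·ξ_α(y)⁻¹·y·c`. -/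
theorem statement13 (n r₁ r₂ k : ℕ) (hn : 2 ≤ n) (hr1 : 1 ≤ r₁) (hrr : r₁ ≤ r₂)
    (hrn : r₂ < n) (hk : k = r₂ - r₁ + 1) (μ : Fin n → ℤ)
    (y U h L : Matrix (Fin n) (Fin n) K) (hG : IsGauss μ y U h L)
    (hPhi : PhiOf n r₂ k hrn U ⟨k - 1, by omega⟩ ≠ 0) :
    (∃ w h' l : Matrix (Fin n) (Fin n) K,
      MemNKalpha1 n r₁ k w ∧ MemT1 h' ∧ IsLowerUni l ∧
      (xiOf n r₁ r₂ k hr1 hrr hrn hk U)⁻¹ * y =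
        w * tPow (addAlpha n r₁ r₂ μ) * h' * l) ∧
    (∃ a c : Matrix (Fin n) (Fin n) K,
      MemNalphaPoly n r₁ k a ∧ MemNnegPoly c ∧
      IsPiOf (addAlpha n r₁ r₂ μ) ((xiOf n r₁ r₂ k hr1 hrr hrn hk U)⁻¹ * y)
        (a * ((xiOf n r₁ r₂ k hr1 hrr hrn hk U)⁻¹ * y) * c)) := by
  obtain ⟨s, rfl⟩ : ∃ s, r₁ = s + 1 := ⟨r₁ - 1, by omega⟩
  obtain ⟨m, rfl⟩ : ∃ m, k = m + 1 := ⟨k - 1, by omega⟩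
  obtain rfl : r₂ = s + 1 + m := by omega
  obtain ⟨hU, hh, hL, rfl⟩ := hG
  have hs : s + (m + 1) < n := by omega
  set A := U.submatrix (blockIncl hs) (blockIncl hs) with hAdef
  have hA : MemN1 A := memN1_submatrix_blockIncl hs hU
  have hlast : blockIncl hs (Fin.last m).succ = ⟨s + 1 + m, hrn⟩ := by
    ext
    simp only [blockIncl, Fin.val_succ, Fin.val_last]
    omega
  set e : ℂ := PhiOf n (s + 1 + m) (m + 1) hrn U ⟨m, by omega⟩ with hedef
  have he : e ≠ 0 := hPhi
  let z := ZetaOf n (s + 1) (s + 1 + m) (m + 1) hr1 hrr hrn hk U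
  let b : Fin m → ℂ := fun i => PhiOf n (s + 1 + m) (m + 1) hrn U ⟨(i : ℕ), by omega⟩
  let g : Fin m → ℂ := fun i => z ⟨m + 1 - (i : ℕ) - 2, by omega⟩ / e
  let p : ℂ := z ⟨m, by omega⟩ / e - ∑ i, b i * g i
  have hxi : xiOf n (s + 1) (s + 1 + m) (m + 1) hr1 hrr hrn hk U =
    blockEmbed n (s + 1) (m + 1) (ymat (m + 1) p e b g) := rfl
  have hxi_inv : (xiOf n (s + 1) (s + 1 + m) (m + 1) hr1 hrr hrn hk U)⁻¹ =
      blockEmbed n (s + 1) (m + 1) (yinv m p e b g) := by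
    refine Matrix.inv_eq_left_inv ?_
    rw [hxi, ← blockEmbed_mul hs, yinv_mul_ymat p e b g he, blockEmbed_one hs]
  have hAe : (A 0 (Fin.last m).succ).coeff 1 = e := by
    rw [hAdef, Matrix.submatrix_apply, hlast, hedef, PhiOf]
    congr 2
    ext
    simp only [blockIncl, Fin.val_zero]
    omega
  have hAb : ∀ i : Fin m, (A i.castSucc.succ (Fin.last m).succ).coeff 1 = b i.rev := by
    intro i
    rw [hAdef, Matrix.submatrix_apply, hlast]
    simp only [b, PhiOf]
    congr 2
    ext
    simp only [blockIncl, Fin.val_succ, Fin.val_castSucc, Fin.val_rev]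
    omega
  have hAg : ∀ i : Fin m, (A 0 i.castSucc.succ).coeff 1 = e * g i.rev := by
    intro i
    simp only [g]
    rw [mul_div_cancel₀ _ he, hAdef, Matrix.submatrix_apply]
    simp only [z, ZetaOf, Fin.val_rev]
    rw [dif_neg (by omega)]
    congr 2
    ext
    simp only [blockIncl, Fin.val_succ, Fin.val_castSucc]
    omega
  have hAp : (A 0 (Fin.last m).succ).coeff 2 = e * (p + ∑ i, b i * g i) := by
    simp only [p]
    rw [sub_add_cancel, mul_div_cancel₀ _ he, hAdef, Matrix.submatrix_apply, hlast]
    simp only [z, ZetaOf]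
    rw [dif_pos (by omega)]
    congr 2
  obtain ⟨a, l, d, ha, hl, hd, hC⟩ := exists_gauss_of_sub_one_mem _ _
    (yinv_mul_sub_one_mem hA he hAe hAb hAg hAp)
  obtain ⟨A', hA', hAA'⟩ := exists_mul_eq_one_of_isUpperUni hA.1
  have hdec := exists_decomposition hs μ hU.1 hh hL.1 ha hl.1 hd hA' hAA' hC
  rw [hxi_inv]
  refine ⟨hdec, ?_⟩
  obtain ⟨w, h', l', hw, hh', hl', hx⟩ := hdec
  exact exists_isPiOf hs _ hw hh' hl' hx

end
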